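/- Let F be a finite field and let P₁, P₂ : F → F be complete permutation polynomials of F. Then the map (x, y) ↦ (P₁(x + y) + y, P₂(x + y) + y) is a bijection of F × F if and only if the map x ↦ P₂(x) - P₁(x) is a bijection of F. -/

import Mathlib

/-- Lemma 5.2: if `P₁, P₂` are complete permutation polynomials of a
finite field `F`, then the quasigroups `Q_i(x,y) = P_i(x+y) + y` are orthogonal iff
`P₂ - P₁` is a bijection of `F`. -/
theorem stmt_16 (F : Type*) [Field F] [Fintype F]
    (P₁ P₂ : F → F)
    (hP₁ : Function.Bijective P₁) (hP₁' : Function.Bijective (fun x : F => P₁ x + x))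
    (hP₂ : Function.Bijective P₂) (hP₂' : Function.Bijective (fun x : F => P₂ x + x)) :
    Function.Bijective (fun z : F × F =>
        (P₁ (z.1 + z.2) + z.2, P₂ (z.1 + z.2) + z.2)) ↔
      Function.Bijective (fun x : F => P₂ x - P₁ x) := by
  rw [← Finite.injective_iff_bijective, ← Finite.injective_iff_bijective]
  constructor
  · intro h a b hab
    have key := @h (a, 0) (b - (P₁ a - P₁ b), P₁ a - P₁ b) (by
      simp only [sub_add_cancel, add_zero, Prod.mk.injEq] at hab ⊢
      exact ⟨by ring, by linear_combination hab⟩)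
    simp only [Prod.mk.injEq] at key
    rw [key.1, ← key.2, sub_zero]
  · rintro h ⟨x, y⟩ ⟨u, v⟩ huv
    simp only [Prod.mk.injEq] at huv
    obtain ⟨h₁, h₂⟩ := huv
    have hs : x + y = u + v := h (by linear_combination h₂ - h₁)
    rw [hs] at h₁
    have hy : y = v := add_left_cancel h₁
    subst hy
    rw [add_right_cancel hs]
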